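/- arXiv:2506.16372 — 6 statements merged into one kernel-verified Lean document; each statement's English description precedes it below -/
import Mathlib

section
/- Let a, b, c be positive integers such that abc is not a cube in ℤ. Then there exists λ among the three rational numbers a/b, b/c, c/a such that the subfield ℚ((abc)^{1/3}) of ℝ is different from the subfield ℚ(λ^{1/3}) of ℝ (where t^{1/3} denotes the real cube root of the positive real number t). -/
open Polynomial in
/-- An element of `ℚ(α)`, where `α ^ 3 = n` is rational, is a rational quadratic expression in
`α`. -/
theorem exists_quadratic_of_mem_adjoin_cubeRoot {α β : ℝ} {n : ℚ} (hα : α ^ 3 = n)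
    (hβ : β ∈ IntermediateField.adjoin ℚ ({α} : Set ℝ)) :
    ∃ x y z : ℚ, β = x + y * α + z * α ^ 2 := by
  have hmonic : (X ^ 3 - C n : ℚ[X]).Monic := monic_X_pow_sub_C n (by norm_num)
  have hroot : aeval α (X ^ 3 - C n : ℚ[X]) = 0 := by simp [hα]
  have hint : IsIntegral ℚ α := ⟨_, hmonic, hroot⟩
  rw [← IntermediateField.mem_toSubalgebra,
    IntermediateField.adjoin_simple_toSubalgebra_of_isAlgebraic hint.isAlgebraic,
    Algebra.adjoin_singleton_eq_range_aeval] at hβ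
  obtain ⟨p, hp⟩ := hβ
  have hp' : aeval α (p %ₘ (X ^ 3 - C n)) = β := by
    rw [← hp]
    exact aeval_modByMonic_eq_self_of_root hroot
  have hdeg : (p %ₘ (X ^ 3 - C n)).natDegree < 3 := by
    have := natDegree_modByMonic_lt p hmonic (fun h1 => by
      have := congrArg natDegree h1
      rw [natDegree_X_pow_sub_C] at this
      simp at this)
    rwa [natDegree_X_pow_sub_C] at this
  refine ⟨(p %ₘ (X ^ 3 - C n)).coeff 0, (p %ₘ (X ^ 3 - C n)).coeff 1,
    (p %ₘ (X ^ 3 - C n)).coeff 2, ?_⟩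
  rw [← hp', aeval_eq_sum_range' hdeg]
  simp [Finset.sum_range_succ, Algebra.smul_def]

/-- If `n` is not a rational cube and `α ^ 3 = n`, then `1, α, α ^ 2` are linearly independent
over `ℚ`. -/
theorem eq_zero_of_quadratic_cubeRoot_eq_zero {α : ℝ} {n : ℚ} (hα : α ^ 3 = n)
    (hn : ∀ r : ℚ, r ^ 3 ≠ n) {x y z : ℚ} (h : (x : ℝ) + y * α + z * α ^ 2 = 0) :
    x = 0 ∧ y = 0 ∧ z = 0 := by
  have irr : ∀ q : ℚ, α ≠ q := fun q hq => hn q (by rw [hq] at hα; exact_mod_cast hα)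
  have lin : ∀ u v : ℚ, (u : ℝ) + v * α = 0 → u = 0 ∧ v = 0 := by
    intro u v huv
    have hv : v = 0 := by
      by_contra hv
      have hv' : (v : ℝ) ≠ 0 := by exact_mod_cast hv
      refine irr (-u / v) ?_
      push_cast
      field_simp
      linarith
    subst hv
    simpa using huv
  obtain ⟨h1, h2⟩ := lin (x * y - n * z ^ 2) (y ^ 2 - x * z) (by
    push_cast
    linear_combination (y - z * α) * h + (z : ℝ) ^ 2 * hα)
  have hz : z = 0 := by
    by_contra hz
    refine hn (y / z) ?_
    field_simp
    linear_combination y * h2 + z * h1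
  subst hz
  have hy : y = 0 := by simpa using h2
  subst hy
  simpa using h

/-- If two real cube roots of rationals generate the same field over `ℚ`, and the first rational
`n` is not a cube, then the second is `n` or `n ^ 2` up to a rational cube. -/
theorem eq_mul_cube_of_adjoin_cubeRoot_eq {α β : ℝ} {n m : ℚ} (hα : α ^ 3 = n) (hβ : β ^ 3 = m)
    (hn : ∀ r : ℚ, r ^ 3 ≠ n)
    (h : IntermediateField.adjoin ℚ ({α} : Set ℝ) = IntermediateField.adjoin ℚ ({β} : Set ℝ)) :
    ∃ t : ℚ, m = n * t ^ 3 ∨ m = n ^ 2 * t ^ 3 := by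
  have hmem : β ∈ IntermediateField.adjoin ℚ ({α} : Set ℝ) :=
    h ▸ IntermediateField.mem_adjoin_simple_self ℚ β
  have irr : ∀ q : ℚ, β ≠ q := by
    rintro q rfl
    have hmem' : α ∈ IntermediateField.adjoin ℚ ({(q : ℝ)} : Set ℝ) :=
      h ▸ IntermediateField.mem_adjoin_simple_self ℚ α
    have hbot : IntermediateField.adjoin ℚ ({(q : ℝ)} : Set ℝ) = ⊥ :=
      IntermediateField.adjoin_simple_eq_bot_iff.2
        (IntermediateField.mem_bot.2 ⟨q, by simp⟩)
    rw [hbot] at hmem'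
    obtain ⟨r, rfl⟩ := IntermediateField.mem_bot.1 hmem'
    refine hn r ?_
    rw [eq_ratCast] at hα
    exact_mod_cast hα
  obtain ⟨x, y, z, hxyz⟩ := exists_quadratic_of_mem_adjoin_cubeRoot hα hmem
  obtain ⟨h0, h1, h2⟩ := eq_zero_of_quadratic_cubeRoot_eq_zero hα hn
    (x := x ^ 3 + n * y ^ 3 + n ^ 2 * z ^ 3 + 6 * n * x * y * z - m)
    (y := 3 * (x ^ 2 * y + n * x * z ^ 2 + n * y ^ 2 * z))
    (z := 3 * (x ^ 2 * z + x * y ^ 2 + n * y * z ^ 2)) (by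
      push_cast
      rw [← hβ, ← hα, hxyz]
      ring)
  have hx : x = 0 := by
    by_contra hx
    have hcube : n * z ^ 3 = y ^ 3 := by
      apply mul_left_cancel₀ hx
      linear_combination z * h1 / 3 - y * h2 / 3
    by_cases hz : z = 0
    · subst hz
      have hy : y = 0 := by simpa using hcube.symm
      subst hy
      exact irr x (by simpa using hxyz)
    · refine hn (y / z) ?_
      field_simp
      linarith
  subst hx
  have hn0 : n ≠ 0 := fun h => hn 0 (by simp [h])
  have hyz : y = 0 ∨ z = 0 := by simpa [hn0] using h1
  rcases hyz with rfl | rfl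
  · exact ⟨z, Or.inr (by linarith)⟩
  · exact ⟨y, Or.inl (by linarith)⟩

/-- An integer that is the cube of a rational is the cube of an integer. -/
theorem exists_int_cube_of_rat_cube {n : ℤ} {r : ℚ} (h : r ^ 3 = n) : ∃ s : ℤ, s ^ 3 = n := by
  obtain ⟨s, rfl⟩ := IsIntegrallyClosed.exists_algebraMap_eq_of_isIntegral_pow
    (R := ℤ) (x := r) (n := 3) (by norm_num) (h ▸ isIntegral_algebraMap (R := ℤ) (x := n))
  exact ⟨s, Int.cast_injective (α := ℚ) (by simpa using h)⟩

/-- **Lemma 4.5 ("juggling cubes").**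
Let `a, b, c` be positive integers such that `a*b*c` is not a cube in `ℤ`.
Then there exists `λ` among `a/b, b/c, c/a` (as rational numbers) such that the
subfield `ℚ((abc)^{1/3})` of `ℝ` is different from the subfield `ℚ(λ^{1/3})` of `ℝ`,
where `t^{1/3}` denotes the real cube root of the positive real number `t`. -/
theorem stmt_0 (a b c : ℤ) (ha : 0 < a) (hb : 0 < b) (hc : 0 < c)
    (h : ¬ ∃ r : ℤ, r ^ 3 = a * b * c) :
    ∃ lam : ℚ, (lam = (a : ℚ) / (b : ℚ) ∨ lam = (b : ℚ) / (c : ℚ) ∨ lam = (c : ℚ) / (a : ℚ)) ∧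
      IntermediateField.adjoin ℚ ({((a * b * c : ℤ) : ℝ) ^ ((1 : ℝ) / 3)} : Set ℝ) ≠
        IntermediateField.adjoin ℚ ({((lam : ℝ)) ^ ((1 : ℝ) / 3)} : Set ℝ) := by
  have hn : ∀ r : ℚ, r ^ 3 ≠ ((a * b * c : ℤ) : ℚ) := fun r hr => h (exists_int_cube_of_rat_cube hr)
  have root : ∀ t : ℝ, 0 ≤ t → (t ^ ((1 : ℝ) / 3)) ^ 3 = t := fun t ht => by
    rw [← Real.rpow_natCast, ← Real.rpow_mul ht]
    norm_num
  have hroot : (((a * b * c : ℤ) : ℝ) ^ ((1 : ℝ) / 3)) ^ 3 = (((a * b * c : ℤ) : ℚ) : ℝ) := by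
    rw [root _ (by exact_mod_cast (by positivity : 0 ≤ a * b * c))]
    norm_cast
  have ha' : (0 : ℚ) < a := by exact_mod_cast ha
  have hb' : (0 : ℚ) < b := by exact_mod_cast hb
  have hc' : (0 : ℚ) < c := by exact_mod_cast hc
  by_contra! hcon
  have key : ∀ lam : ℚ, 0 < lam →
      (lam = (a : ℚ) / b ∨ lam = (b : ℚ) / c ∨ lam = (c : ℚ) / a) →
      ∃ t : ℚ, lam = ((a * b * c : ℤ) : ℚ) * t ^ 3 ∨ lam = ((a * b * c : ℤ) : ℚ) ^ 2 * t ^ 3 :=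
    fun lam hpos hlam => eq_mul_cube_of_adjoin_cubeRoot_eq hroot
      (root _ (by exact_mod_cast hpos.le)) hn (hcon lam hlam)
  obtain ⟨t, ht⟩ := key _ (div_pos ha' hb') (Or.inl rfl)
  obtain ⟨u, hu⟩ := key _ (div_pos hb' hc') (Or.inr (Or.inl rfl))
  obtain ⟨v, hv⟩ := key _ (div_pos hc' ha') (Or.inr (Or.inr rfl))
  have hprod : (a : ℚ) / b * (b / c) * (c / a) = 1 := by field_simp
  have hratio : ((a * b * c : ℤ) : ℚ) * (b / c) = b ^ 3 * (a / b) := by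
    push_cast
    field_simp
  have hn0 : ((a * b * c : ℤ) : ℚ) ≠ 0 := by
    push_cast
    positivity
  have hu0 : u ≠ 0 := by
    rintro rfl
    have : (b : ℚ) / c ≠ 0 := by positivity
    simp_all
  generalize ((a * b * c : ℤ) : ℚ) = n at *
  have same : n * u ^ 3 = b ^ 3 * t ^ 3 → False := fun h' => hn (b * t / u) (by
    field_simp
    linear_combination -h')
  have four : n ^ 4 * (t * u * v) ^ 3 = 1 → False := fun h' => hn (n⁻¹ * (t * u * v)⁻¹) (by
    have : t * u * v ≠ 0 := fun h0 => by simp [h0] at h'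
    generalize t * u * v = w at *
    field_simp
    linear_combination -h')
  have five : n ^ 5 * (t * u * v) ^ 3 = 1 → False := fun h' => hn (n ^ 2 * (t * u * v)) (by
    linear_combination n * h')
  rcases ht with ht | ht <;> rcases hu with hu | hu <;> rcases hv with hv | hv <;>
    rw [ht, hu, hv] at hprod <;> rw [ht, hu] at hratio
  · exact same (mul_left_cancel₀ hn0 (by linear_combination hratio))
  · exact four (by linear_combination hprod)
  · exact four (by linear_combination hprod)
  · exact five (by linear_combination hprod)
  · exact four (by linear_combination hprod)
  · exact five (by linear_combination hprod)
  · exact five (by linear_combination hprod)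
  · exact same (mul_left_cancel₀ (pow_ne_zero 2 hn0) (by linear_combination hratio))
end

section
/- Let a, b, c be positive integers such that abc is not a cube in ℚ. Then there exists λ among the three rational numbers a/b, b/c, c/a such that neither abc·λ⁻¹ nor abc·λ⁻² is the cube of a rational number. -/
/-- Two elements of a field differ by a cube, up to the convention on zero. -/
def EqModCubes {K : Type*} [Field K] (x y : K) : Prop := ∃ r : K, x = y * r ^ 3

namespace EqModCubes

variable {K : Type*} [Field K] {x y z : K}

theorem symm (hx : x ≠ 0) (h : EqModCubes x y) : EqModCubes y x := by
  obtain ⟨r, rfl⟩ := h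
  have hr : r ≠ 0 := by rintro rfl; simp at hx
  exact ⟨r⁻¹, by field_simp⟩

theorem exists_pow_eq_mul (hx : EqModCubes x z) (hy : EqModCubes y z) :
    ∃ r : K, r ^ 3 = x * y * z := by
  obtain ⟨r, rfl⟩ := hx
  obtain ⟨s, rfl⟩ := hy
  exact ⟨z * r * s, by ring⟩

end EqModCubes

/-- If `xyz` is a cube times `x / y` or `(x / y) ^ 2`, then `z` agrees modulo cubes with `y`
or with `x`, respectively. -/
theorem eqModCubes_of_pow_eq {K : Type*} [Field K] {x y z : K} (hx : x ≠ 0) (hy : y ≠ 0)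
    (h : (∃ r : K, r ^ 3 = x * y * z * (x / y)⁻¹) ∨
      ∃ r : K, r ^ 3 = x * y * z * (x / y)⁻¹ ^ 2) :
    EqModCubes z y ∨ EqModCubes z x := by
  rcases h with ⟨r, hr⟩ | ⟨r, hr⟩
  · refine .inl ⟨r / y, ?_⟩
    rw [div_pow, hr]
    field_simp
  · refine .inr ⟨r / y, ?_⟩
    rw [div_pow, hr]
    field_simp


/-- **Reformulation of Lemma 4.5.**
Let `a, b, c` be positive integers such that `a*b*c` is not a cube in `ℚ`.
Then there exists `λ` among `a/b, b/c, c/a` such that neither `abc·λ⁻¹` nor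
`abc·λ⁻²` is the cube of a rational number. -/
theorem stmt_1 (a b c : ℤ) (ha : 0 < a) (hb : 0 < b) (hc : 0 < c)
    (h : ¬ ∃ r : ℚ, r ^ 3 = ((a * b * c : ℤ) : ℚ)) :
    ∃ lam : ℚ, (lam = (a : ℚ) / (b : ℚ) ∨ lam = (b : ℚ) / (c : ℚ) ∨ lam = (c : ℚ) / (a : ℚ)) ∧
      (¬ ∃ r : ℚ, r ^ 3 = ((a * b * c : ℤ) : ℚ) * lam⁻¹) ∧
      (¬ ∃ r : ℚ, r ^ 3 = ((a * b * c : ℤ) : ℚ) * (lam⁻¹) ^ 2) := by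
  have ha' : (a : ℚ) ≠ 0 := by exact_mod_cast ha.ne'
  have hb' : (b : ℚ) ≠ 0 := by exact_mod_cast hb.ne'
  have hc' : (c : ℚ) ≠ 0 := by exact_mod_cast hc.ne'
  push_cast at h ⊢
  by_contra hcon
  have key (l : ℚ) (hl : l = (a : ℚ) / b ∨ l = (b : ℚ) / c ∨ l = (c : ℚ) / a) :
      (∃ r : ℚ, r ^ 3 = a * b * c * l⁻¹) ∨ ∃ r : ℚ, r ^ 3 = a * b * c * l⁻¹ ^ 2 := by
    by_contra! hn
    exact hcon ⟨l, hl, fun ⟨r, hr⟩ => hn.1 r hr, fun ⟨r, hr⟩ => hn.2 r hr⟩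
  have hbca : (b * c * a : ℚ) = a * b * c := by ring
  have hcab : (c * a * b : ℚ) = a * b * c := by ring
  have hcacb := eqModCubes_of_pow_eq ha' hb' (key _ (.inl rfl))
  have habac := eqModCubes_of_pow_eq (z := (a : ℚ)) hb' hc'
    (by rw [hbca]; exact key _ (.inr (.inl rfl)))
  have hbcba := eqModCubes_of_pow_eq (z := (b : ℚ)) hc' ha'
    (by rw [hcab]; exact key _ (.inr (.inr rfl)))
  have hA (h₁ : EqModCubes (b : ℚ) a) (h₂ : EqModCubes (c : ℚ) a) : False := by
    obtain ⟨r, hr⟩ := h₁.exists_pow_eq_mul h₂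
    exact h ⟨r, by rw [hr, hbca]⟩
  have hB (h₁ : EqModCubes (c : ℚ) b) (h₂ : EqModCubes (a : ℚ) b) : False := by
    obtain ⟨r, hr⟩ := h₁.exists_pow_eq_mul h₂
    exact h ⟨r, by rw [hr, hcab]⟩
  have hC (h₁ : EqModCubes (a : ℚ) c) (h₂ : EqModCubes (b : ℚ) c) : False :=
    h (h₁.exists_pow_eq_mul h₂)
  have hab : EqModCubes (a : ℚ) b ↔ EqModCubes (b : ℚ) a := ⟨.symm ha', .symm hb'⟩
  have hbc : EqModCubes (b : ℚ) c ↔ EqModCubes (c : ℚ) b := ⟨.symm hb', .symm hc'⟩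
  have hca : EqModCubes (c : ℚ) a ↔ EqModCubes (a : ℚ) c := ⟨.symm hc', .symm ha'⟩
  tauto
end

section
/- Let G be an (additive) abelian group, ρ an automorphism of G with ρ∘ρ∘ρ = id, and H a subgroup of G such that ρ(g) − g ∈ H for every g ∈ G. Let n be a natural number coprime to 3. Then every x ∈ G with n·x = 0 can be written as x = y + h where ρ(y) = y, n·y = 0, h ∈ H, and n·h = 0. In other words, Gₙ = Gₙ^ρ + Hₙ, where Gₙ denotes the n-torsion subgroup, Gₙ^ρ its ρ-fixed part, and Hₙ the n-torsion of H. -/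
/-- Let `G` be an abelian group, `ρ` an automorphism of `G` with `ρ∘ρ∘ρ = id`, and `H` a
subgroup of `G` such that `ρ(g) − g ∈ H` for every `g ∈ G`. Let `n` be a natural number
coprime to `3`. Then every `x ∈ G` with `n·x = 0` can be written as `x = y + h` where
`ρ(y) = y`, `n·y = 0`, `h ∈ H`, and `n·h = 0`; i.e. `Gₙ = Gₙ^ρ + Hₙ`. -/
theorem stmt_3 {G : Type*} [AddCommGroup G] (ρ : G ≃+ G) (hρ : ∀ g : G, ρ (ρ (ρ g)) = g)
    (H : AddSubgroup G) (hH : ∀ g : G, ρ g - g ∈ H) (n : ℕ) (hn : Nat.Coprime n 3) :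
    ∀ x : G, n • x = 0 →
      ∃ y h : G, x = y + h ∧ ρ y = y ∧ n • y = 0 ∧ h ∈ H ∧ n • h = 0 := by
  intro x hx
  obtain ⟨a, b, hab⟩ : IsCoprime (n : ℤ) 3 := Nat.isCoprime_iff_coprime.mpr hn
  have h1 : n • ρ x = 0 := by rw [← map_nsmul, hx, map_zero]
  have h2 : n • ρ (ρ x) = 0 := by rw [← map_nsmul, h1, map_zero]
  have hx3 : b • (3 : ℤ) • x = x := by
    have h : (a * n + b * 3) • x = x := by rw [hab, one_smul]
    rwa [add_smul, mul_smul, mul_smul, natCast_zsmul, hx, smul_zero, zero_add] at h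
  refine ⟨b • (x + ρ x + ρ (ρ x)), b • ((x - ρ x) + (x - ρ (ρ x))), ?_, ?_, ?_, ?_, ?_⟩
  · rw [← smul_add]
    refine hx3.symm.trans (congrArg (b • ·) ?_)
    module
  · rw [map_zsmul, map_add, map_add, hρ]
    module
  · simp only [smul_comm n b, smul_add, hx, h1, h2, add_zero, smul_zero]
  · refine H.zsmul_mem (H.add_mem ?_ ?_) b
    · simpa using H.neg_mem (hH x)
    · simpa [hρ] using hH (ρ (ρ x))
  · simp only [smul_comm n b, smul_add, smul_sub, hx, h1, h2, sub_zero, add_zero, smul_zero]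
end

section
/- For every integer c, let M be the 4×4 integer matrix with rows (1, 1, 2, −c), (1, 0, 0, 0), (−1, 0, −1, c), (0, 0, 0, 1). Then M³ is the identity matrix, and the kernel of 1 + M + M² acting on ℤ⁴ equals the image of M − 1 acting on ℤ⁴; in particular every v ∈ ℤ⁴ with (1 + M + M²)·v = 0 is of the form (M − 1)·w for some w ∈ ℤ⁴. -/
/-- **(Lemma 3.6, CM case.)** For every integer `c`, let `M` be the `4×4` integer matrix with
rows `(1, 1, 2, −c)`, `(1, 0, 0, 0)`, `(−1, 0, −1, c)`, `(0, 0, 0, 1)`. Then `M³ = 1` and the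
kernel of `1 + M + M²` acting on `ℤ⁴` equals the image of `M − 1` acting on `ℤ⁴`. -/
theorem stmt_5 (c : ℤ) :
    let M : Matrix (Fin 4) (Fin 4) ℤ :=
      !![1, 1, 2, -c; 1, 0, 0, 0; -1, 0, -1, c; 0, 0, 0, 1]
    M ^ 3 = 1 ∧
      ∀ v : Fin 4 → ℤ, (1 + M + M ^ 2).mulVec v = 0 ↔ ∃ w : Fin 4 → ℤ, (M - 1).mulVec w = v := by
  intro M
  have hsq : M ^ 2 = !![0, 1, 0, 0; 1, 1, 2, -c; 0, -1, -1, c; 0, 0, 0, 1] := by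
    rw [pow_two]
    ext i j
    fin_cases i <;> fin_cases j <;> simp [M, Matrix.mul_apply, Fin.sum_univ_four] <;> ring
  have hcube : M ^ 3 = 1 := by
    rw [pow_succ, hsq]
    ext i j
    fin_cases i <;> fin_cases j <;> simp [M, Matrix.mul_apply, Fin.sum_univ_four] <;> ring
  refine ⟨hcube, fun v => ⟨fun h => ?_, ?_⟩⟩
  · have hnorm : 1 + M + M ^ 2 =
        !![2, 2, 2, -c; 2, 2, 2, -c; -1, -1, -1, 2 * c; 0, 0, 0, 3] := by
      rw [hsq]
      ext i j
      fin_cases i <;> fin_cases j <;> simp [M] <;> ring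
    rw [hnorm] at h
    have h2 := congrFun h 2
    have h3 := congrFun h 3
    simp [Matrix.mulVec, dotProduct, Fin.sum_univ_four] at h2 h3
    rw [h3] at h2
    refine ⟨![v 0 + v 1, v 0, 0, 0], ?_⟩
    ext i
    fin_cases i <;>
      simp [M, Matrix.mulVec, dotProduct, Fin.sum_univ_four] <;> linarith
  · rintro ⟨w, rfl⟩
    have hzero : (1 + M + M ^ 2) * (M - 1) = 0 := by
      have : (1 + M + M ^ 2) * (M - 1) = M ^ 3 - 1 := by noncomm_ring
      rw [this, hcube, sub_self]
    rw [Matrix.mulVec_mulVec, hzero, Matrix.zero_mulVec]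
end

section
/- Let N be the 3×3 integer matrix with rows (1, 1, 2), (1, 0, 0), (−1, 0, −1). Then N³ is the identity matrix, and the kernel of 1 + N + N² acting on ℤ³ equals the image of N − 1 acting on ℤ³; in particular every v ∈ ℤ³ with (1 + N + N²)·v = 0 is of the form (N − 1)·w for some w ∈ ℤ³. -/
/-- **(Lemma 3.6, non-CM case.)** Let `N` be the `3×3` integer matrix with rows
`(1, 1, 2)`, `(1, 0, 0)`, `(−1, 0, −1)`. Then `N³ = 1` and the kernel of `1 + N + N²`
acting on `ℤ³` equals the image of `N − 1` acting on `ℤ³`. -/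
theorem stmt_6 :
    let N : Matrix (Fin 3) (Fin 3) ℤ := !![1, 1, 2; 1, 0, 0; -1, 0, -1]
    N ^ 3 = 1 ∧
      ∀ v : Fin 3 → ℤ, (1 + N + N ^ 2).mulVec v = 0 ↔ ∃ w : Fin 3 → ℤ, (N - 1).mulVec w = v := by
  intro N
  have hsum : 1 + N + N ^ 2 = !![2, 2, 2; 2, 2, 2; -1, -1, -1] := by decide
  have hsub : N - 1 = !![0, 1, 2; 1, -1, 0; -1, 0, -2] := by decide
  refine ⟨by decide, fun v => ?_⟩
  rw [hsum, hsub]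
  constructor
  · intro h
    have h2 := congrFun h 2
    simp [Matrix.mulVec, dotProduct, Fin.sum_univ_three] at h2
    refine ⟨![-v 2, v 0, 0], ?_⟩
    ext i
    fin_cases i <;> simp [Matrix.mulVec, dotProduct, Fin.sum_univ_three]
    linarith
  · rintro ⟨w, rfl⟩
    ext i
    fin_cases i <;> simp [Matrix.mulVec, dotProduct, Fin.sum_univ_three] <;> ring
end

section
/- Let a, b, c be nonzero integers with gcd(a, b, c) = 1 such that 4abc is the cube of a rational number. Then the diagonal cubic a·x³ + b·y³ + c·z³ = 0 has a nontrivial solution over the field ℚ₂ of 2-adic numbers: there exist x, y, z ∈ ℚ₂, not all zero, with a·x³ + b·y³ + c·z³ = 0. -/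
/-- Every unit of `ℤ₂` is a cube. -/
theorem exists_pow_three_eq_of_isUnit (u : ℤ_[2]) (hu : IsUnit u) : ∃ t : ℤ_[2], t ^ 3 = u := by
  have h3 : ‖(3 : ℤ_[2])‖ = 1 := by
    rw [← PadicInt.isUnit_iff]
    by_contra h
    have h2 : ‖((3 : ℤ) : ℤ_[2])‖ < 1 := by
      exact_mod_cast PadicInt.not_isUnit_iff.1 h
    rw [PadicInt.norm_intCast_lt_one_iff] at h2
    norm_num at h2
  have hu1 : ‖1 - u‖ < 1 := by
    rw [← PadicInt.mem_nonunits, ← IsLocalRing.mem_maximalIdeal, ← PadicInt.ker_toZMod,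
      RingHom.mem_ker, map_sub, map_one]
    have h := hu.map (PadicInt.toZMod (p := 2))
    generalize PadicInt.toZMod u = v at h
    revert v
    decide
  obtain ⟨t, ht, -⟩ := hensels_lemma (p := 2)
    (F := (Polynomial.X ^ 3 - Polynomial.C u : Polynomial ℤ_[2])) (a := 1) (by
      have hd : (Polynomial.derivative
          (Polynomial.X ^ 3 - Polynomial.C u : Polynomial ℤ_[2])).aeval (1 : ℤ_[2]) = 3 := by
        simp
        norm_num
      rw [hd, h3]
      simpa using hu1)
  exact ⟨t, by simpa [sub_eq_zero] using ht⟩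

/-- A nonzero 2-adic number whose valuation is divisible by 3 is a cube. -/
theorem exists_pow_three_eq_of_three_dvd_valuation (w : ℚ_[2]) (hw : w ≠ 0)
    (h : 3 ∣ w.valuation) : ∃ t : ℚ_[2], t ^ 3 = w := by
  obtain ⟨k, hk⟩ := h
  have hn : ‖w * ((2 : ℚ_[2]) ^ (-k)) ^ 3‖ = 1 := by
    have h2 : ‖(2 : ℚ_[2])‖ = 2⁻¹ := by simpa using Padic.norm_p (p := 2)
    rw [norm_mul, norm_pow, norm_zpow, h2, Padic.norm_eq_zpow_neg_valuation hw, hk]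
    rw [← zpow_natCast, ← zpow_mul, inv_zpow', Nat.cast_ofNat, ← zpow_add₀ (by norm_num)]
    push_cast
    rw [show -(3 * k) + -(-k * 3) = 0 by ring, zpow_zero]
  obtain ⟨t, ht⟩ := exists_pow_three_eq_of_isUnit ⟨_, hn.le⟩ (PadicInt.isUnit_iff.2 hn)
  have ht' : (t : ℚ_[2]) ^ 3 = w * ((2 : ℚ_[2]) ^ (-k)) ^ 3 := by
    have := congrArg (fun x : ℤ_[2] => (x : ℚ_[2])) ht
    simpa using this
  have h0 : (2 : ℚ_[2]) ^ (-k) ≠ 0 := zpow_ne_zero _ two_ne_zero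
  exact ⟨t / 2 ^ (-k), by rw [div_pow, ht']; field_simp⟩

/-- If the valuations of two nonzero 2-adic numbers agree modulo 3, the binary diagonal cubic form
with these coefficients is isotropic. -/
theorem exists_mul_pow_three_add_eq_zero (x y : ℚ_[2]) (hx : x ≠ 0) (hy : y ≠ 0)
    (h : 3 ∣ y.valuation - x.valuation) : ∃ t : ℚ_[2], x * t ^ 3 + y = 0 := by
  obtain ⟨t, ht⟩ := exists_pow_three_eq_of_three_dvd_valuation (y / x) (div_ne_zero hy hx) (by
    rwa [div_eq_mul_inv, Padic.valuation_mul hy (inv_ne_zero hx), Padic.valuation_inv])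
  refine ⟨-t, ?_⟩
  rw [Odd.neg_pow (by decide), ht]
  field_simp
  ring


/-- Let `a, b, c` be nonzero integers with `gcd(a, b, c) = 1` such that `4abc` is the cube of
a rational number. Then the diagonal cubic `a·x³ + b·y³ + c·z³ = 0` has a nontrivial solution
over the field `ℚ₂` of 2-adic numbers. -/
theorem stmt_8 (a b c : ℤ) (ha : a ≠ 0) (hb : b ≠ 0) (hc : c ≠ 0)
    (hgcd : Int.gcd (Int.gcd a b) c = 1)
    (hcube : ∃ r : ℚ, r ^ 3 = ((4 * a * b * c : ℤ) : ℚ)) :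
    ∃ x y z : ℚ_[2], ¬(x = 0 ∧ y = 0 ∧ z = 0) ∧
      (a : ℚ_[2]) * x ^ 3 + (b : ℚ_[2]) * y ^ 3 + (c : ℚ_[2]) * z ^ 3 = 0 := by
  have ha' : (a : ℚ_[2]) ≠ 0 := Int.cast_ne_zero.2 ha
  have hb' : (b : ℚ_[2]) ≠ 0 := Int.cast_ne_zero.2 hb
  have hc' : (c : ℚ_[2]) ≠ 0 := Int.cast_ne_zero.2 hc
  obtain ⟨r, hr⟩ := hcube
  have hr' : (r : ℚ_[2]) ^ 3 = (2 : ℚ_[2]) ^ 2 * a * b * c := by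
    have := congrArg (fun q : ℚ => (q : ℚ_[2])) hr
    push_cast at this
    rw [this]
    ring
  have hv2 : (2 : ℚ_[2]).valuation = 1 := Padic.valuation_p (p := 2)
  have hv := congrArg Padic.valuation hr'
  rw [Padic.valuation_pow, Padic.valuation_mul (by simp [ha, hb]) hc',
    Padic.valuation_mul (by simp [ha]) hb', Padic.valuation_mul (by simp) ha',
    Padic.valuation_pow, hv2] at hv
  push_cast at hv
  have hcases : 3 ∣ (b : ℚ_[2]).valuation - (a : ℚ_[2]).valuation ∨
      3 ∣ (c : ℚ_[2]).valuation - (a : ℚ_[2]).valuation ∨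
      3 ∣ (c : ℚ_[2]).valuation - (b : ℚ_[2]).valuation := by
    generalize (a : ℚ_[2]).valuation = i at *
    generalize (b : ℚ_[2]).valuation = j at *
    generalize (c : ℚ_[2]).valuation = k at *
    have hi : i % 3 = 0 ∨ i % 3 = 1 ∨ i % 3 = 2 := by omega
    have hj : j % 3 = 0 ∨ j % 3 = 1 ∨ j % 3 = 2 := by omega
    rcases hi with hi | hi | hi <;> rcases hj with hj | hj | hj <;> omega
  rcases hcases with h | h | h
  · obtain ⟨t, ht⟩ := exists_mul_pow_three_add_eq_zero _ _ ha' hb' h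
    exact ⟨t, 1, 0, by simp, by simpa using ht⟩
  · obtain ⟨t, ht⟩ := exists_mul_pow_three_add_eq_zero _ _ ha' hc' h
    exact ⟨t, 0, 1, by simp, by simpa using ht⟩
  · obtain ⟨t, ht⟩ := exists_mul_pow_three_add_eq_zero _ _ hb' hc' h
    exact ⟨0, t, 1, by simp, by simpa using ht⟩
end
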